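/- (4-point property.) For all q, q' ∈ K_q and r ∈ K_r, the inequality φ(q, R(q')) ≤ φ(q, r) + δ(q, q') holds in the extended reals. -/

import Mathlib

noncomputable section

open Finset

variable {X Y J : Type*}

/-- `f(u,v) = u·log u − u·log v` with the conventions `f(0,v) = 0` and `f(u,0) = +∞` for `u > 0`,
taking values in the extended reals. -/
def fdiv (u v : ℝ) : EReal :=
  if u = 0 then 0
  else if v = 0 then (⊤ : EReal)
  else ((u * Real.log u - u * Real.log v : ℝ) : EReal)

/-- Marginal `p_x := ∑_y p_{x,y}`. -/
def margX [Fintype Y] (p : X → Y → ℝ) (x : X) : ℝ := ∑ y, p x y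

/-- Marginal `p^y := ∑_x p_{x,y}`. -/
def margY [Fintype X] (p : X → Y → ℝ) (y : Y) : ℝ := ∑ x, p x y

/-- The polytope `K_q`: `q_{j|x} ≥ 0`, `∑_{j∋x} q_{j|x} = 1` for every `x`,
and `q_{j|x} = 0` whenever `x ∉ j`. -/
def Kq [Fintype J] [DecidableEq X] (S : J → Finset X) : Set (J → X → ℝ) :=
  {q | (∀ j x, 0 ≤ q j x) ∧ (∀ x, (∑ j, if x ∈ S j then q j x else 0) = 1) ∧
    (∀ j x, x ∉ S j → q j x = 0)}

/-- The polytope `K_r`: `r_{j|y} ≥ 0` and `∑_j r_{j|y} = 1` for every `y`. -/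
def Kr (J Y : Type*) [Fintype J] : Set (J → Y → ℝ) :=
  {r | (∀ j y, 0 ≤ r j y) ∧ ∀ y, (∑ j, r j y) = 1}

/-- `φ(q,r) := ∑_{x,y,j} p_{x,y} · f(q_{j|x}, r_{j|y})`, extended-real valued. -/
def phi [Fintype X] [Fintype Y] [Fintype J] (p : X → Y → ℝ)
    (q : J → X → ℝ) (r : J → Y → ℝ) : EReal :=
  ∑ x, ∑ y, ∑ j, (p x y : EReal) * fdiv (q j x) (r j y)

/-- `δ(q,q') := ∑_x p_x ∑_{j∋x} f(q_{j|x}, q'_{j|x})`, extended-real valued. -/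
def delta [Fintype X] [Fintype Y] [Fintype J] [DecidableEq X] (p : X → Y → ℝ)
    (S : J → Finset X) (q q' : J → X → ℝ) : EReal :=
  ∑ x, (margX p x : EReal) * ∑ j, (if x ∈ S j then fdiv (q j x) (q' j x) else 0)

/-- `R_{j|y}(q) := ∑_{x∈j} p_{x|y} q_{j|x}`. -/
def Rmap [Fintype X] [Fintype Y] [DecidableEq X] (p : X → Y → ℝ) (S : J → Finset X)
    (q : J → X → ℝ) : J → Y → ℝ :=
  fun j y => ∑ x, if x ∈ S j then (p x y / margY p y) * q j x else 0

/-- `A_x(r) := ∑_{j∋x} ∏_y (r_{j|y})^{p^{y|x}}` (real powers, with `0^0 = 1`). -/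
def Afun [Fintype Y] [Fintype J] [DecidableEq X] (p : X → Y → ℝ) (S : J → Finset X)
    (r : J → Y → ℝ) (x : X) : ℝ :=
  ∑ j, if x ∈ S j then (∏ y, r j y ^ (p x y / margX p x)) else 0

/-- `Q_{j|x}(r) := (∏_y (r_{j|y})^{p^{y|x}}) / A_x(r)` if `x ∈ j`, and `0` otherwise. -/
def Qmap [Fintype Y] [Fintype J] [DecidableEq X] (p : X → Y → ℝ) (S : J → Finset X)
    (r : J → Y → ℝ) : J → X → ℝ :=
  fun j x => if x ∈ S j then (∏ y, r j y ^ (p x y / margX p x)) / Afun p S r x else 0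

open Classical in
/-- `φ_r(r) := −∑_x p_x log A_x(r)`, equal to `+∞` if `A_x(r) = 0` for some `x`. -/
def phiR [Fintype X] [Fintype Y] [Fintype J] [DecidableEq X] (p : X → Y → ℝ)
    (S : J → Finset X) (r : J → Y → ℝ) : EReal :=
  if ∃ x, Afun p S r x = 0 then ⊤
  else (((- ∑ x, margX p x * Real.log (Afun p S r x)) : ℝ) : EReal)

/-- The explicit real-valued formula for `φ_q`:
`∑_x p_x ∑_{j∋x} q_{j|x} log q_{j|x} − ∑_y p^y ∑_j R_{j|y}(q) log R_{j|y}(q)`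
(with the convention `0·log 0 = 0`, automatic since `Real.log 0 = 0`). -/
def phiQexp [Fintype X] [Fintype Y] [Fintype J] [DecidableEq X] (p : X → Y → ℝ)
    (S : J → Finset X) (q : J → X → ℝ) : ℝ :=
  (∑ x, margX p x * ∑ j, if x ∈ S j then q j x * Real.log (q j x) else 0)
    - ∑ y, margY p y * ∑ j, Rmap p S q j y * Real.log (Rmap p S q j y)

/-- The convex corner `K_a := {a : 0 ≤ a_x ≤ A_x(r) (∀x) for some r ∈ K_r}`. -/
def Ka [Fintype X] [Fintype Y] [Fintype J] [DecidableEq X] (p : X → Y → ℝ)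
    (S : J → Finset X) : Set (X → ℝ) :=
  {a | ∃ r ∈ Kr J Y, ∀ x, 0 ≤ a x ∧ a x ≤ Afun p S r x}

open Classical in
/-- `φ_a(a) := −∑_x p_x log a_x`, equal to `+∞` if `a_x = 0` for some `x`. -/
def phiA [Fintype X] [Fintype Y] (p : X → Y → ℝ) (a : X → ℝ) : EReal :=
  if ∃ x, a x = 0 then ⊤
  else (((- ∑ x, margX p x * Real.log (a x)) : ℝ) : EReal)

theorem EReal.coe_mul_sum {ι : Type*} (s : Finset ι) {a : ℝ} (ha : 0 ≤ a) (f : ι → EReal) :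
    (a : EReal) * ∑ i ∈ s, f i = ∑ i ∈ s, (a : EReal) * f i := by
  classical
  induction s using Finset.induction_on with
  | empty => simp
  | insert i s hi ih =>
    rw [Finset.sum_insert hi, Finset.sum_insert hi, ← ih,
      EReal.left_distrib_of_nonneg_of_ne_top (by exact_mod_cast ha) (EReal.coe_ne_top a)]

theorem EReal.coe_sum_mul {ι : Type*} (s : Finset ι) {a : ι → ℝ} (ha : ∀ i, 0 ≤ a i)
    (b : EReal) : ((∑ i ∈ s, a i : ℝ) : EReal) * b = ∑ i ∈ s, (a i : EReal) * b := by
  classical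
  induction s using Finset.induction_on with
  | empty => simp
  | insert i s hi ih =>
    rw [Finset.sum_insert hi, Finset.sum_insert hi, ← ih, EReal.coe_add,
      EReal.right_distrib_of_nonneg (by exact_mod_cast ha i)
        (by exact_mod_cast Finset.sum_nonneg fun i _ => ha i)]

theorem EReal.coe_finset_sum {ι : Type*} (s : Finset ι) (a : ι → ℝ) :
    ((∑ i ∈ s, a i : ℝ) : EReal) = ∑ i ∈ s, (a i : EReal) := by
  classical
  induction s using Finset.induction_on with
  | empty => simp
  | insert i s hi ih => rw [Finset.sum_insert hi, Finset.sum_insert hi, EReal.coe_add, ih]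

theorem mul_log_four_point {u u' v v' : ℝ} (hu : 0 < u) (hu' : 0 < u') (hv : 0 < v)
    (hv' : 0 < v') :
    u * Real.log u - u * Real.log v' ≤
      (u * Real.log u - u * Real.log v) + (u * Real.log u - u * Real.log u') +
        (v * u' / v' - u) := by
  have h := Real.log_le_sub_one_of_pos (x := v * u' / (v' * u)) (by positivity)
  rw [Real.log_div (by positivity) (by positivity), Real.log_mul hv.ne' hu'.ne',
    Real.log_mul hv'.ne' hu.ne'] at h
  have h2 := mul_le_mul_of_nonneg_left h hu.le
  have h3 : u * (v * u' / (v' * u) - 1) = v * u' / v' - u := by field_simp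
  rw [h3] at h2
  linarith

theorem fdiv_zero_left (v : ℝ) : fdiv 0 v = 0 := if_pos rfl

theorem fdiv_zero_right {u : ℝ} (hu : u ≠ 0) : fdiv u 0 = ⊤ := by simp [fdiv, hu]

theorem fdiv_of_ne_zero {u v : ℝ} (hu : u ≠ 0) (hv : v ≠ 0) :
    fdiv u v = ((u * Real.log u - u * Real.log v : ℝ) : EReal) := by simp [fdiv, hu, hv]

theorem coe_mul_fdiv_four_point {p u u' v v' : ℝ} (hp : 0 ≤ p) (hu : 0 ≤ u) (hu' : 0 ≤ u')
    (hv : 0 ≤ v) (hv' : 0 ≤ v') (h : 0 < p → 0 < u' → 0 < v') :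
    (p : EReal) * fdiv u v' ≤
      p * fdiv u v + p * fdiv u u' + ((p * (v * u' / v' - u) : ℝ) : EReal) := by
  rcases hp.eq_or_lt with rfl | hp
  · simp
  rcases hu.eq_or_lt with rfl | hu
  · simp only [fdiv_zero_left, mul_zero, zero_add, sub_zero]
    exact_mod_cast (by positivity : 0 ≤ p * (v * u' / v'))
  have hbot : ∀ w, (p : EReal) * fdiv u w ≠ ⊥ := fun w => by
    by_cases hw : w = 0
    · rw [hw, fdiv_zero_right hu.ne', EReal.coe_mul_top_of_pos hp]
      exact top_ne_bot
    · rw [fdiv_of_ne_zero hu.ne' hw, ← EReal.coe_mul]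
      exact EReal.coe_ne_bot _
  rcases hv.eq_or_lt with rfl | hv
  · rw [fdiv_zero_right hu.ne', EReal.coe_mul_top_of_pos hp, EReal.top_add_of_ne_bot (hbot _),
      EReal.top_add_coe]
    exact le_top
  rcases hu'.eq_or_lt with rfl | hu'
  · rw [fdiv_zero_right hu.ne', EReal.coe_mul_top_of_pos hp, EReal.add_top_of_ne_bot (hbot _),
      EReal.top_add_coe]
    exact le_top
  have hv' := h hp hu'
  rw [fdiv_of_ne_zero hu.ne' hv'.ne', fdiv_of_ne_zero hu.ne' hv.ne',
    fdiv_of_ne_zero hu.ne' hu'.ne']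
  norm_cast
  rw [← mul_add, ← mul_add]
  exact mul_le_mul_of_nonneg_left (mul_log_four_point hu hu' hv hv') hp.le

theorem sum_eq_one_of_mem_Kq [Fintype J] [DecidableEq X] {S : J → Finset X} {q : J → X → ℝ}
    (hq : q ∈ Kq S) (x : X) : ∑ j, q j x = 1 := by
  rw [← hq.2.1 x]
  refine Finset.sum_congr rfl fun j _ => ?_
  split_ifs with hx
  exacts [rfl, hq.2.2 j x hx]

theorem Rmap_eq_sum_div [Fintype X] [Fintype Y] [Fintype J] [DecidableEq X] (p : X → Y → ℝ)
    {S : J → Finset X} {q : J → X → ℝ} (hq : q ∈ Kq S) (j : J) (y : Y) :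
    Rmap p S q j y = (∑ x, p x y * q j x) / margY p y := by
  rw [Finset.sum_div]
  refine Finset.sum_congr rfl fun x _ => ?_
  split_ifs with hx
  · ring
  · simp [hq.2.2 j x hx]

theorem delta_eq_sum [Fintype X] [Fintype Y] [Fintype J] [DecidableEq X] {p : X → Y → ℝ}
    (hp : ∀ x y, 0 ≤ p x y) {S : J → Finset X} {q : J → X → ℝ} (hq : q ∈ Kq S)
    (q' : J → X → ℝ) :
    delta p S q q' = ∑ x, ∑ y, ∑ j, (p x y : EReal) * fdiv (q j x) (q' j x) := by
  refine Finset.sum_congr rfl fun x _ => ?_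
  rw [margX, EReal.coe_sum_mul _ (hp x)]
  refine Finset.sum_congr rfl fun y _ => ?_
  rw [EReal.coe_mul_sum _ (hp x y)]
  refine Finset.sum_congr rfl fun j _ => ?_
  split_ifs with hx
  · rfl
  · rw [hq.2.2 j x hx, fdiv_zero_left]

theorem sum_mul_Rmap_ratio_sub_nonpos [Fintype X] [Fintype Y] [Fintype J] [DecidableEq X]
    {p : X → Y → ℝ} (hpy : ∀ y, 0 < margY p y) {S : J → Finset X} {q q' : J → X → ℝ}
    (hq : q ∈ Kq S) (hq' : q' ∈ Kq S) {r : J → Y → ℝ} (hr : r ∈ Kr J Y) :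
    ∑ x, ∑ y, ∑ j, p x y * (r j y * q' j x / Rmap p S q' j y - q j x) ≤ 0 := by
  simp only [mul_sub, Finset.sum_sub_distrib, ← Finset.mul_sum, sum_eq_one_of_mem_Kq hq, mul_one]
  rw [sub_nonpos, Finset.sum_comm, Finset.sum_comm (f := fun x y => p x y)]
  refine Finset.sum_le_sum fun y _ => ?_
  calc ∑ x, p x y * ∑ j, r j y * q' j x / Rmap p S q' j y
      = ∑ j, r j y * (margY p y * (Rmap p S q' j y / Rmap p S q' j y)) := by
        simp only [Finset.mul_sum]
        rw [Finset.sum_comm]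
        refine Finset.sum_congr rfl fun j _ => ?_
        have h : ∑ x, p x y * q' j x = margY p y * Rmap p S q' j y := by
          rw [Rmap_eq_sum_div p hq', mul_div_cancel₀ _ (hpy y).ne']
        rw [← mul_div_assoc, ← h, Finset.sum_div, Finset.mul_sum]
        exact Finset.sum_congr rfl fun x _ => by ring
    _ ≤ ∑ j, r j y * margY p y := by
        refine Finset.sum_le_sum fun j _ => mul_le_mul_of_nonneg_left ?_ (hr.1 j y)
        exact mul_le_of_le_one_right (hpy y).le (div_self_le_one _)
    _ = ∑ x, p x y := by rw [← Finset.sum_mul, hr.2 y, one_mul, margY]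

/-- 4-point property: for all `q, q' ∈ K_q` and `r ∈ K_r`,
`φ(q, R(q')) ≤ φ(q, r) + δ(q, q')` in the extended reals. -/
theorem four_point_property (X Y J : Type*) [Fintype X] [Fintype Y] [Fintype J]
    [Nonempty X] [Nonempty Y] [DecidableEq X]
    (p : X → Y → ℝ) (S : J → Finset X)
    (hp : ∀ x y, 0 ≤ p x y) (hptot : ∑ x, ∑ y, p x y = 1)
    (hpx : ∀ x, 0 < margX p x) (hpy : ∀ y, 0 < margY p y)
    (hcov : ∀ x, ∃ j, x ∈ S j) :
    ∀ q ∈ Kq S, ∀ q' ∈ Kq S, ∀ r ∈ Kr J Y,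
      phi p q (Rmap p S q') ≤ phi p q r + delta p S q q' := by
  intro q hq q' hq' r hr
  have hR : ∀ x y j, 0 < p x y → 0 < q' j x → 0 < Rmap p S q' j y := fun x y j hxy hjx => by
    rw [Rmap_eq_sum_div p hq']
    refine div_pos ((mul_pos hxy hjx).trans_le ?_) (hpy y)
    exact Finset.single_le_sum (f := fun x => p x y * q' j x)
      (fun x _ => mul_nonneg (hp x y) (hq'.1 j x)) (Finset.mem_univ x)
  have hR0 : ∀ j y, 0 ≤ Rmap p S q' j y := fun j y => by
    rw [Rmap_eq_sum_div p hq']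
    exact div_nonneg (Finset.sum_nonneg fun x _ => mul_nonneg (hp x y) (hq'.1 j x)) (hpy y).le
  calc phi p q (Rmap p S q')
      ≤ ∑ x, ∑ y, ∑ j, ((p x y : EReal) * fdiv (q j x) (r j y) + p x y * fdiv (q j x) (q' j x) +
          ((p x y * (r j y * q' j x / Rmap p S q' j y - q j x) : ℝ) : EReal)) :=
        Finset.sum_le_sum fun x _ => Finset.sum_le_sum fun y _ => Finset.sum_le_sum fun j _ =>
          coe_mul_fdiv_four_point (hp x y) (hq.1 j x) (hq'.1 j x) (hr.1 j y) (hR0 j y) (hR x y j)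
    _ = phi p q r + delta p S q q' +
          ((∑ x, ∑ y, ∑ j, p x y * (r j y * q' j x / Rmap p S q' j y - q j x) : ℝ) : EReal) := by
        simp only [Finset.sum_add_distrib, phi, delta_eq_sum hp hq, EReal.coe_finset_sum]
    _ ≤ phi p q r + delta p S q q' := by
        refine add_le_of_nonpos_right ?_
        exact_mod_cast sum_mul_Rmap_ratio_sub_nonpos hpy hq hq' hr
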